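/- Let G be a connected simple graph in which every block is either a cycle or a complete graph, and suppose G contains at least one cycle of length ≥ 4. Then there exists a cycle C of some length r ≥ 4 in G such that r−2 consecutive vertices of C are not contained in any other cycle of length ≥ 4 in G. -/

import Mathlib

open SimpleGraph

/-- `v` is a cut vertex of `G`: some two vertices distinct from `v` are connected in `G`
but not after deleting `v`. -/
def SimpleGraph.IsCutVertex {V : Type*} (G : SimpleGraph V) (v : V) : Prop :=
  ∃ u w : V, ∃ (hu : u ≠ v) (hw : w ≠ v), G.Reachable u w ∧
    ¬ (G.induce {x | x ≠ v}).Reachable ⟨u, hu⟩ ⟨w, hw⟩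

/-- `B` is (the vertex set of) a block of `G`: a maximal connected subgraph with no
cut vertex. -/
def SimpleGraph.IsBlock {V : Type*} (G : SimpleGraph V) (B : Set V) : Prop :=
  B.Nonempty ∧ (G.induce B).Connected ∧ (∀ v, ¬ (G.induce B).IsCutVertex v) ∧
    ∀ C : Set V, B ⊆ C → (G.induce C).Connected →
      (∀ v, ¬ (G.induce C).IsCutVertex v) → B = C

/-- The block `B` of `G` is a cycle of length `r`. -/
def SimpleGraph.IsCycleBlock {V : Type*} (G : SimpleGraph V) (B : Set V) (r : ℕ) : Prop :=
  G.IsBlock B ∧ Nonempty ((G.induce B) ≃g cycleGraph r)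

namespace FreeCyc

/-- `a` and `b` are joined by a walk inside `S`. -/
def Conn {V : Type*} (G : SimpleGraph V) (S : Set V) (a b : V) : Prop :=
  ∃ p : G.Walk a b, ∀ u ∈ p.support, u ∈ S

variable {V : Type*} {G : SimpleGraph V}

theorem Conn.symm {S : Set V} {a b : V} (h : Conn G S a b) : Conn G S b a := by
  obtain ⟨p, hp⟩ := h
  exact ⟨p.reverse, by simpa using hp⟩

theorem Conn.trans {S : Set V} {a b c : V} (h : Conn G S a b) (h' : Conn G S b c) :
    Conn G S a c := by
  obtain ⟨p, hp⟩ := h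
  obtain ⟨q, hq⟩ := h'
  refine ⟨p.append q, fun u hu => ?_⟩
  rw [Walk.mem_support_append_iff] at hu
  exact hu.elim (hp u) (hq u)

theorem Conn.mono {S T : Set V} {a b : V} (hST : S ⊆ T) (h : Conn G S a b) : Conn G T a b := by
  obtain ⟨p, hp⟩ := h
  exact ⟨p, fun u hu => hST (hp u hu)⟩

theorem Conn.refl {S : Set V} {a : V} (h : a ∈ S) : Conn G S a a :=
  ⟨Walk.nil, by simpa using h⟩

theorem reach_iff {S : Set V} {a b : V} (ha : a ∈ S) (hb : b ∈ S) :
    (G.induce S).Reachable ⟨a, ha⟩ ⟨b, hb⟩ ↔ Conn G S a b := by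
  constructor
  · rintro ⟨p⟩
    refine ⟨p.map (Embedding.induce S).toHom, fun u hu => ?_⟩
    replace hu : u ∈ (p.map (Embedding.induce (G := G) S).toHom).support := hu
    rw [Walk.support_map, List.mem_map] at hu
    obtain ⟨w, -, rfl⟩ := hu
    exact w.2
  · rintro ⟨p, hp⟩
    exact ⟨p.induce S hp⟩

theorem reach2_iff {S : Set V} {v a b : S} (ha : a ≠ v) (hb : b ≠ v) :
    ((G.induce S).induce {x | x ≠ v}).Reachable ⟨a, ha⟩ ⟨b, hb⟩ ↔
      Conn G (S \ {v.1}) a.1 b.1 := by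
  rw [reach_iff (G := G.induce S) (S := {x | x ≠ v}) ha hb]
  constructor
  · rintro ⟨p, hp⟩
    refine ⟨p.map (Embedding.induce S).toHom, fun u hu => ?_⟩
    replace hu : u ∈ (p.map (Embedding.induce (G := G) S).toHom).support := hu
    rw [Walk.support_map, List.mem_map] at hu
    obtain ⟨w, hw, rfl⟩ := hu
    refine ⟨w.2, fun h => hp w hw ?_⟩
    exact Subtype.ext h
  · rintro ⟨p, hp⟩
    refine ⟨p.induce S (fun u hu => (hp u hu).1), fun u hu h => ?_⟩
    subst h
    rw [Walk.support_induce] at hu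
    simp at hu
    exact (hp _ hu).2 rfl

theorem block_conn {B : Set V} (hB : G.IsBlock B) {a b : V} (ha : a ∈ B) (hb : b ∈ B) :
    Conn G B a b :=
  (reach_iff ha hb).1 (hB.2.1.preconnected _ _)

theorem block_conn_diff {B : Set V} (hB : G.IsBlock B) (v : V) {a b : V} (ha : a ∈ B)
    (hb : b ∈ B) (hav : a ≠ v) (hbv : b ≠ v) : Conn G (B \ {v}) a b := by
  by_cases hv : v ∈ B
  · by_contra hcon
    refine hB.2.2.1 ⟨v, hv⟩ ⟨⟨a, ha⟩, ⟨b, hb⟩, ?_, ?_, hB.2.1.preconnected _ _, ?_⟩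
    · simpa using hav
    · simpa using hbv
    · rw [reach2_iff]
      exact hcon
  · refine (block_conn hB ha hb).mono fun u hu => ⟨hu, ?_⟩
    rintro rfl
    exact hv hu

theorem block_max {B C : Set V} (hB : G.IsBlock B) (hBC : B ⊆ C)
    (h1 : ∀ a ∈ C, ∀ b ∈ C, Conn G C a b)
    (h2 : ∀ v, ∀ a ∈ C, ∀ b ∈ C, a ≠ v → b ≠ v → Conn G (C \ {v}) a b) : B = C := by
  refine hB.2.2.2 C hBC ?_ ?_
  · obtain ⟨b, hb⟩ := hB.1
    have : Nonempty C := ⟨⟨b, hBC hb⟩⟩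
    refine ⟨fun a b => (reach_iff a.2 b.2).2 (h1 _ a.2 _ b.2)⟩
  · rintro v ⟨a, b, ha, hb, -, hn⟩
    refine hn ((reach2_iff ha hb).2 (h2 v _ a.2 _ b.2 ?_ ?_))
    · exact fun h => ha (Subtype.ext h)
    · exact fun h => hb (Subtype.ext h)

/-- A vertex of a path other than `v` is joined to one of the ends avoiding `v`. -/
theorem path_split {a b : V} (p : G.Walk a b) (hp : p.IsPath) (v u : V) (hu : u ∈ p.support)
    (huv : u ≠ v) :
    (a ≠ v ∧ Conn G ({x | x ∈ p.support} \ {v}) a u) ∨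
      (b ≠ v ∧ Conn G ({x | x ∈ p.support} \ {v}) b u) := by
  classical
  suffices h : Conn G ({x | x ∈ p.support} \ {v}) a u ∨ Conn G ({x | x ∈ p.support} \ {v}) b u by
    rcases h with h | h
    · left
      obtain ⟨q, hq⟩ := h
      exact ⟨(hq _ q.start_mem_support).2, q, hq⟩
    · right
      obtain ⟨q, hq⟩ := h
      exact ⟨(hq _ q.start_mem_support).2, q, hq⟩
  by_cases hv : v ∈ (p.takeUntil u hu).support
  · right
    refine ⟨(p.dropUntil u hu).reverse, fun x hx => ?_⟩
    rw [Walk.support_reverse, List.mem_reverse] at hx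
    refine ⟨p.support_dropUntil_subset_support hu hx, ?_⟩
    rintro rfl
    have hs := hp.support_nodup
    rw [← p.take_spec hu, Walk.support_append] at hs
    have hx' : x ∈ (p.dropUntil u hu).support.tail := by
      rw [Walk.mem_support_iff] at hx
      exact hx.resolve_left huv.symm
    exact (List.disjoint_of_nodup_append hs) hv hx'
  · left
    refine ⟨p.takeUntil u hu, fun x hx => ⟨p.support_takeUntil_subset_support hu hx, ?_⟩⟩
    rintro rfl
    exact hv hx

theorem blocks_eq {B B' : Set V} (hB : G.IsBlock B) (hB' : G.IsBlock B') {y b b' : V}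
    (hy : y ∈ B) (hy' : y ∈ B') (hb : b ∈ B) (hb' : b' ∈ B') (hby : b ≠ y) (hby' : b' ≠ y)
    (h : Conn G {x | x ≠ y} b b') : B = B' := by
  classical
  obtain ⟨p0, hp0⟩ := h
  obtain ⟨p, hp, hpy⟩ : ∃ p : G.Walk b b', p.IsPath ∧ ∀ u ∈ p.support, u ≠ y :=
    ⟨p0.bypass, p0.bypass_isPath, fun u hu => hp0 u (p0.support_bypass_subset_support hu)⟩
  clear hp0 p0
  set P : Set V := {x | x ∈ p.support} with hP
  set C : Set V := B ∪ B' ∪ P with hC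
  have hBC : B ⊆ C := fun x hx => Or.inl (Or.inl hx)
  have hBC' : B' ⊆ C := fun x hx => Or.inl (Or.inr hx)
  have hPC : P ⊆ C := fun x hx => Or.inr hx
  have sd : ∀ {S T : Set V} (v : V), S ⊆ T → S \ {v} ⊆ T \ {v} :=
    fun v h x hx => ⟨h hx.1, hx.2⟩
  have h1 : ∀ a ∈ C, Conn G C y a := by
    rintro a ((ha | ha) | ha)
    · exact (block_conn hB hy ha).mono hBC
    · exact (block_conn hB' hy' ha).mono hBC'
    · refine ((block_conn hB hy hb).mono hBC).trans ?_
      exact ⟨p.takeUntil a ha, fun x hx => hPC (p.support_takeUntil_subset_support ha hx)⟩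
  have h2 : ∀ v, ∃ z, ∀ a ∈ C, a ≠ v → Conn G (C \ {v}) z a := by
    intro v
    by_cases hv : v = y
    · subst hv
      have hbp : ∀ a ∈ P, Conn G (C \ {v}) b a := fun a ha =>
        ⟨p.takeUntil a ha, fun x hx => ⟨hPC (p.support_takeUntil_subset_support ha hx),
          hpy x (p.support_takeUntil_subset_support ha hx)⟩⟩
      refine ⟨b, ?_⟩
      rintro a ((ha | ha) | ha) hav
      · exact (block_conn_diff hB v hb ha hby hav).mono (sd v hBC)
      · exact (hbp b' p.end_mem_support).trans
          ((block_conn_diff hB' v hb' ha hby' hav).mono (sd v hBC'))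
      · exact hbp a ha
    · have hyv : y ≠ v := fun h => hv h.symm
      have e1 : ∀ a ∈ B, a ≠ v → Conn G (C \ {v}) y a := fun a ha hav =>
        (block_conn_diff hB v hy ha hyv hav).mono (sd v hBC)
      have e2 : ∀ a ∈ B', a ≠ v → Conn G (C \ {v}) y a := fun a ha hav =>
        (block_conn_diff hB' v hy' ha hyv hav).mono (sd v hBC')
      refine ⟨y, ?_⟩
      rintro a ((ha | ha) | ha) hav
      · exact e1 a ha hav
      · exact e2 a ha hav
      · rcases path_split p hp v a ha hav with ⟨hne, hc⟩ | ⟨hne, hc⟩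
        · exact (e1 b hb hne).trans (hc.mono (sd v hPC))
        · exact (e2 b' hb' hne).trans (hc.mono (sd v hPC))
  have h1' : ∀ a ∈ C, ∀ b ∈ C, Conn G C a b := fun a ha b hb => (h1 a ha).symm.trans (h1 b hb)
  have h2' : ∀ v, ∀ a ∈ C, ∀ b ∈ C, a ≠ v → b ≠ v → Conn G (C \ {v}) a b := by
    intro v a ha b hb hav hbv
    obtain ⟨z, hz⟩ := h2 v
    exact (hz a ha hav).symm.trans (hz b hb hbv)
  exact (block_max hB hBC h1' h2').trans (block_max hB' hBC' h1' h2').symm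

/-- The part of `G - x` attached to `B`. -/
def K (G : SimpleGraph V) (B : Set V) (x : V) : Set V :=
  {z | ∃ b ∈ B, b ≠ x ∧ Conn G {u | u ≠ x} b z}

theorem K_ssubset {B B' : Set V} (hB : G.IsBlock B) (hB' : G.IsBlock B') (hne : B' ≠ B) {x y : V}
    (hx : x ∈ B) (hy : y ∈ B) (hyx : y ≠ x) (hy' : y ∈ B') : K G B' y ⊂ K G B x := by
  classical
  have hxK : x ∉ K G B' y := by
    rintro ⟨b', hb', hne', hc⟩
    exact hne (blocks_eq hB' hB hy' hy hb' hx hne' hyx.symm hc)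
  have hxB' : x ∉ B' := fun h => hxK ⟨x, h, hyx.symm, Conn.refl hyx.symm⟩
  refine (Set.ssubset_iff_of_subset ?_).2 ⟨y, ⟨y, hy, hyx, Conn.refl hyx⟩, ?_⟩
  · rintro z ⟨b', hb', hne', p, hp⟩
    refine ⟨y, hy, hyx, Conn.trans ((block_conn hB' hy' hb').mono ?_) ⟨p, ?_⟩⟩
    · rintro u hu rfl
      exact hxB' hu
    · rintro u hu rfl
      exact hxK ⟨b', hb', hne', p.takeUntil u hu,
        fun w hw => hp w (p.support_takeUntil_subset_support hu hw)⟩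
  · rintro ⟨b', hb', hne', p, hp⟩
    exact hp y p.end_mem_support rfl

end FreeCyc

/-- **Jayanthan–Sarkar, Lemma 3.1.** If `G` is a connected graph in which every block is a
cycle or a clique and `G` has a cycle (block) of length `≥ 4`, then there is a cycle `C`
of some length `r ≥ 4` in `G` such that `r - 2` consecutive vertices of `C` lie in no
other cycle of length `≥ 4` of `G`. -/
theorem exists_cycleBlock_with_free_consecutive_vertices {V : Type*} [Fintype V]
    (G : SimpleGraph V) (hconn : G.Connected)
    (hblocks : ∀ B : Set V, G.IsBlock B →
      (∃ r : ℕ, 3 ≤ r ∧ Nonempty ((G.induce B) ≃g cycleGraph r)) ∨ G.IsClique B)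
    (hbig : ∃ (B : Set V) (r : ℕ), 4 ≤ r ∧ G.IsCycleBlock B r) :
    ∃ (B : Set V) (r : ℕ) (hr : 4 ≤ r) (hB : G.IsBlock B)
      (e : (G.induce B) ≃g cycleGraph r) (i : ℕ),
      ∀ t : ℕ, t < r - 2 →
        ∀ (B' : Set V) (r' : ℕ), 4 ≤ r' → G.IsCycleBlock B' r' → B' ≠ B →
          (↑(e.symm ⟨(i + t) % r, Nat.mod_lt _ (by omega)⟩) : V) ∉ B' := by
  classical
  obtain ⟨B0, r0, hr0, hB0⟩ := hbig
  obtain ⟨x0, hx0⟩ := hB0.1.1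
  let Q : Set (Set V × V) := {q | q.2 ∈ q.1 ∧ ∃ r, 4 ≤ r ∧ G.IsCycleBlock q.1 r}
  obtain ⟨⟨B, x⟩, ⟨hx, r, hr, hB, ⟨e⟩⟩, hmin⟩ :=
    (measure fun q : Set V × V => (FreeCyc.K G q.1 q.2).ncard).wf.has_min Q
      ⟨(B0, x0), hx0, r0, hr0, hB0⟩
  refine ⟨B, r, hr, hB, e, (e ⟨x, hx⟩).val + 1, ?_⟩
  intro t ht B' r' hr' hB' hne hmem
  have hlt := (e ⟨x, hx⟩).isLt
  generalize hk : (⟨((e ⟨x, hx⟩).val + 1 + t) % r, Nat.mod_lt _ (by omega)⟩ : Fin r) = k at hmem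
  have hyx : (e.symm k : V) ≠ x := by
    intro h
    have h1 : e.symm k = ⟨x, hx⟩ := Subtype.ext h
    have h2 : k = e ⟨x, hx⟩ := by rw [← h1]; simp
    have h3 : ((e ⟨x, hx⟩).val + 1 + t) % r = (e ⟨x, hx⟩).val :=
      (congrArg Fin.val hk).trans (congrArg Fin.val h2)
    by_cases hc : (e ⟨x, hx⟩).val + 1 + t < r
    · rw [Nat.mod_eq_of_lt hc] at h3
      omega
    · rw [Nat.mod_eq_sub_mod (by omega), Nat.mod_eq_of_lt (by omega)] at h3
      omega
  have hss := FreeCyc.K_ssubset hB hB'.1 hne hx (e.symm k).2 hyx hmem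
  exact hmin (B', (e.symm k : V)) ⟨hmem, r', hr', hB'⟩ (Set.ncard_lt_ncard hss (Set.toFinite _))
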